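/- Let H0 and H1 be two hierarchies on [n], and let T0 and T1 be the triplet sets induced by H0 and H1 respectively. Then the triplet revenues are symmetric under exchange: Trev(H0, T1) = Trev(H1, T0). -/

import Mathlib

open Finset MeasureTheory

namespace CompHC

/-- A rooted binary tree with leaves labelled by elements of `Fin n`. -/
inductive HTree (n : ℕ) : Type
  | leaf (i : Fin n) : HTree n
  | node (l r : HTree n) : HTree n

namespace HTree

/-- The list of leaf labels of a tree. -/
def leaves {n : ℕ} : HTree n → List (Fin n)
  | .leaf i => [i]
  | .node l r => l.leaves ++ r.leaves

/-- The number of leaves of a tree. -/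
def size {n : ℕ} (t : HTree n) : ℕ := t.leaves.length

/-- `|H(i ∨ j)|`: the number of leaves of the smallest subtree containing both `i` and `j`. -/
def lcaSize {n : ℕ} : HTree n → Fin n → Fin n → ℕ
  | .leaf _, _, _ => 1
  | .node l r, i, j =>
      if i ∈ l.leaves ∧ j ∈ l.leaves then l.lcaSize i j
      else if i ∈ r.leaves ∧ j ∈ r.leaves then r.lcaSize i j
      else l.size + r.size

/-- Sum of `f |N1| |N2|` over the internal nodes `N` of the tree, `N1, N2` its children. -/
def internalSum {n : ℕ} (f : ℕ → ℕ → ℕ) : HTree n → ℕ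
  | .leaf _ => 0
  | .node l r => f l.size r.size + l.internalSum f + r.internalSum f

end HTree

/-- A hierarchy on `[n]`: every object appears exactly once as a leaf. -/
def IsHierarchy {n : ℕ} (t : HTree n) : Prop :=
  t.leaves.Nodup ∧ ∀ i : Fin n, i ∈ t.leaves

abbrev Triplet (n : ℕ) := Fin n × Fin n × Fin n
abbrev Quadruplet (n : ℕ) := Fin n × Fin n × Fin n × Fin n

/-- The entries of a triplet are pairwise distinct. -/
def distinctTriplet {n : ℕ} (t : Triplet n) : Prop :=
  t.1 ≠ t.2.1 ∧ t.1 ≠ t.2.2 ∧ t.2.1 ≠ t.2.2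

/-- A quadruplet `(i,j,k,l)` satisfies `i<j`, `k<l`, `(i,j) ≠ (k,l)`. -/
def validQuadruplet {n : ℕ} (q : Quadruplet n) : Prop :=
  q.1 < q.2.1 ∧ q.2.2.1 < q.2.2.2 ∧ (q.1, q.2.1) ≠ (q.2.2.1, q.2.2.2)

/-- Triplet revenue `Trev(H,T) = Σ_{(i,j,k)∈T} (|H(i∨k)| − |H(i∨j)|)`. -/
def Trev {n : ℕ} (H : HTree n) (T : Finset (Triplet n)) : ℤ :=
  ∑ t ∈ T, ((H.lcaSize t.1 t.2.2 : ℤ) - (H.lcaSize t.1 t.2.1 : ℤ))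

/-- Quadruplet revenue `Qrev(H,Q) = Σ_{(i,j,k,l)∈Q} (|H(k∨l)| − |H(i∨j)|)`. -/
def Qrev {n : ℕ} (H : HTree n) (Q : Finset (Quadruplet n)) : ℤ :=
  ∑ q ∈ Q, ((H.lcaSize q.2.2.1 q.2.2.2 : ℤ) - (H.lcaSize q.1 q.2.1 : ℤ))

/-- The set of pairs `(i,j)` with `i < j`. -/
def pairs (n : ℕ) : Finset (Fin n × Fin n) :=
  Finset.univ.filter fun p => p.1 < p.2

/-- Dasgupta's cost `Dcost(H,s) = Σ_{i<j} s_{ij}·|H(i∨j)|`. -/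
noncomputable def Dcost {n : ℕ} (H : HTree n) (s : Fin n → Fin n → ℝ) : ℝ :=
  ∑ p ∈ pairs n, s p.1 p.2 * (H.lcaSize p.1 p.2 : ℝ)

/-- The AddS3 similarity computed from a triplet set. -/
def sAddS3 {n : ℕ} (T : Finset (Triplet n)) (i j : Fin n) : ℤ :=
  ∑ k ∈ Finset.univ.filter (fun k : Fin n => k ≠ i ∧ k ≠ j),
    (((if (i, j, k) ∈ T then 1 else 0) - (if (i, k, j) ∈ T then 1 else 0)
      + (if (j, i, k) ∈ T then 1 else 0) - (if (j, k, i) ∈ T then 1 else 0) : ℤ))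

/-- The AddS4 similarity computed from a quadruplet set. -/
def sAddS4 {n : ℕ} (Q : Finset (Quadruplet n)) (i j : Fin n) : ℤ :=
  ∑ p ∈ (pairs n).filter (fun p => p ≠ (i, j)),
    (((if (i, j, p.1, p.2) ∈ Q then 1 else 0)
      - (if (p.1, p.2, i, j) ∈ Q then 1 else 0) : ℤ))

/-- The triplet set induced by a hierarchy `H0`:
`T0 = {(i,j,k) : i,j,k pairwise distinct, |H0(i∨j)| < min(|H0(i∨k)|, |H0(j∨k)|)}`. -/
def inducedTriplets {n : ℕ} (H : HTree n) : Finset (Triplet n) :=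
  Finset.univ.filter fun t : Triplet n =>
    t.1 ≠ t.2.1 ∧ t.1 ≠ t.2.2 ∧ t.2.1 ≠ t.2.2 ∧
    H.lcaSize t.1 t.2.1 < min (H.lcaSize t.1 t.2.2) (H.lcaSize t.2.1 t.2.2)


namespace HTree

variable {n : ℕ}

theorem lcaSize_comm (t : HTree n) (i j : Fin n) : t.lcaSize i j = t.lcaSize j i := by
  induction t with
  | leaf => rfl
  | node l r ihl ihr => simp only [lcaSize, ihl, ihr, and_comm]

theorem size_node (l r : HTree n) : (node l r).size = l.size + r.size := by
  simp [size, leaves]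

theorem size_pos (t : HTree n) : 0 < t.size := by
  induction t with
  | leaf => simp [size, leaves]
  | node l r ihl ihr => rw [size_node]; omega

theorem lcaSize_le_size (t : HTree n) (i j : Fin n) : t.lcaSize i j ≤ t.size := by
  induction t with
  | leaf => simp [lcaSize, size, leaves]
  | node l r ihl ihr =>
    simp only [lcaSize, size_node]
    split_ifs <;> omega

/-- Among leaves `i ≠ j` and `k` of a binary tree, exactly one pair merges strictly first. -/
theorem lcaSize_triple (t : HTree n) (ht : t.leaves.Nodup) {i j k : Fin n}
    (hi : i ∈ t.leaves) (hj : j ∈ t.leaves) (hk : k ∈ t.leaves)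
    (hij : i ≠ j) :
    (t.lcaSize i j < t.lcaSize i k ∧ t.lcaSize i k = t.lcaSize j k) ∨
    (t.lcaSize i k < t.lcaSize i j ∧ t.lcaSize i j = t.lcaSize j k) ∨
    (t.lcaSize j k < t.lcaSize i j ∧ t.lcaSize i j = t.lcaSize i k) := by
  induction t with
  | leaf a => simp_all [leaves]
  | node l r ihl ihr =>
    simp only [leaves, List.nodup_append', List.mem_append] at ht hi hj hk
    obtain ⟨hl, hr, hd⟩ := ht
    have hpl := l.size_pos
    have hpr := r.size_pos
    have h1 := l.lcaSize_le_size i j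
    have h2 := l.lcaSize_le_size i k
    have h3 := l.lcaSize_le_size j k
    have h4 := r.lcaSize_le_size i j
    have h5 := r.lcaSize_le_size i k
    have h6 := r.lcaSize_le_size j k
    have hdi := @hd i
    have hdj := @hd j
    have hdk := @hd k
    by_cases ai : i ∈ l.leaves <;> by_cases aj : j ∈ l.leaves <;> by_cases ak : k ∈ l.leaves <;>
      simp_all [lcaSize] <;> omega

/-- The indicator of the triplets induced by a tree. -/
def tripletInd (t : HTree n) (i j k : Fin n) : ℤ :=
  if i ≠ j ∧ i ≠ k ∧ j ≠ k ∧ t.lcaSize i j < min (t.lcaSize i k) (t.lcaSize j k) then 1 else 0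

theorem sum_map_tripletInd (t : HTree n) (ht : t.leaves.Nodup) {i j : Fin n}
    (hi : i ∈ t.leaves) (hj : j ∈ t.leaves) (hij : i ≠ j) :
    (t.leaves.map (t.tripletInd i j)).sum = t.size - t.lcaSize i j := by
  induction t with
  | leaf a => simp_all [leaves]
  | node l r ihl ihr =>
    have hn : ∀ k, (node l r).lcaSize i k ≤ l.size + r.size := fun k =>
      size_node l r ▸ lcaSize_le_size _ _ _
    simp only [leaves, List.nodup_append', List.mem_append] at ht hi hj
    obtain ⟨hl, hr, hd⟩ := ht
    have hpl := l.size_pos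
    have hpr := r.size_pos
    have h1 := l.lcaSize_le_size i j
    have h2 := r.lcaSize_le_size i j
    rw [size_node, leaves, List.map_append, List.sum_append]
    by_cases hbl : i ∈ l.leaves ∧ j ∈ l.leaves
    · obtain ⟨ai, aj⟩ := hbl
      have e1 : l.leaves.map ((node l r).tripletInd i j) = l.leaves.map (l.tripletInd i j) :=
        List.map_congr_left fun k hk => by simp [tripletInd, lcaSize, ai, aj, hk]
      have e2 : r.leaves.map ((node l r).tripletInd i j) = r.leaves.map (fun _ => 1) :=
        List.map_congr_left fun k hk => by
          have hkl : k ∉ l.leaves := fun h => hd h hk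
          have hik : i ≠ k := fun h => hkl (h ▸ ai)
          have hjk : j ≠ k := fun h => hkl (h ▸ aj)
          have hir : i ∉ r.leaves := hd ai
          have hjr : j ∉ r.leaves := hd aj
          simp [tripletInd, lcaSize, ai, aj, hkl, hir, hjr, hij, hik, hjk]
          omega
      rw [e1, e2, ihl hl ai aj]
      simp [lcaSize, ai, aj, size]
      ring
    by_cases hbr : i ∈ r.leaves ∧ j ∈ r.leaves
    · obtain ⟨ai, aj⟩ := hbr
      have hil : i ∉ l.leaves := fun h => hd h ai
      have hjl : j ∉ l.leaves := fun h => hd h aj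
      have e1 : r.leaves.map ((node l r).tripletInd i j) = r.leaves.map (r.tripletInd i j) :=
        List.map_congr_left fun k hk => by simp [tripletInd, lcaSize, ai, aj, hil, hjl, hk]
      have e2 : l.leaves.map ((node l r).tripletInd i j) = l.leaves.map (fun _ => 1) :=
        List.map_congr_left fun k hk => by
          have hkr : k ∉ r.leaves := hd hk
          have hik : i ≠ k := fun h => hil (h ▸ hk)
          have hjk : j ≠ k := fun h => hjl (h ▸ hk)
          simp [tripletInd, lcaSize, ai, aj, hkr, hil, hjl, hij, hik, hjk]
          omega
      rw [e1, e2, ihr hr ai aj]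
      simp [lcaSize, ai, aj, hil, hjl, size]
      ring
    · have e : (node l r).lcaSize i j = l.size + r.size := by simp only [lcaSize, hbl, hbr, if_false]
      have e0 : (node l r).tripletInd i j = fun _ => 0 := by
        funext k
        have hk := hn k
        simp only [tripletInd, e]
        rw [if_neg]
        omega
      simp [e0, e]

theorem tripletInd_self (t : HTree n) (i k : Fin n) : t.tripletInd i i k = 0 := by
  simp [tripletInd]

theorem tripletInd_comm (t : HTree n) (i j k : Fin n) :
    t.tripletInd i j k = t.tripletInd j i k := by
  simp only [tripletInd, t.lcaSize_comm i j, min_comm (t.lcaSize i k), ne_comm (a := i) (b := j)]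
  congr 1
  apply propext
  tauto

theorem sum_tripletInd (t : HTree n) (ht : IsHierarchy t) {i j : Fin n} (hij : i ≠ j) :
    ∑ k, t.tripletInd i j k = n - t.lcaSize i j := by
  have hu : t.leaves.toFinset = univ := by
    ext a
    simp [ht.2 a]
  have hs : t.size = n := by
    rw [size, ← List.toFinset_card_of_nodup ht.1, hu, card_fin]
  rw [← hu, List.sum_toFinset _ ht.1, t.sum_map_tripletInd ht.1 (ht.2 i) (ht.2 j) hij, hs]

theorem tripletInd_cyclic_sum (t : HTree n) (ht : IsHierarchy t) (i j k : Fin n) :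
    t.tripletInd i j k + t.tripletInd i k j + t.tripletInd j k i =
      if i ≠ j ∧ i ≠ k ∧ j ≠ k then 1 else 0 := by
  by_cases h : i ≠ j ∧ i ≠ k ∧ j ≠ k
  · have h3 := t.lcaSize_triple ht.1 (ht.2 i) (ht.2 j) (ht.2 k) h.1
    obtain ⟨hij, hik, hjk⟩ := h
    simp only [tripletInd, hij, hik, hjk, hij.symm, hik.symm, hjk.symm, ne_eq, not_false_eq_true,
      true_and, and_self, if_true, lt_min_iff, t.lcaSize_comm j i, t.lcaSize_comm k i,
      t.lcaSize_comm k j]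
    split_ifs <;> omega
  · rw [if_neg h]
    simp only [tripletInd]
    rw [if_neg, if_neg, if_neg] <;> first | rfl | grind

end HTree

theorem sum_distinct_third {n : ℕ} {i j : Fin n} (hij : i ≠ j) :
    ∑ k, (if i ≠ j ∧ i ≠ k ∧ j ≠ k then 1 else 0 : ℤ) = n - 2 := by
  have h : ∀ k, (if i ≠ j ∧ i ≠ k ∧ j ≠ k then 1 else 0 : ℤ) =
      1 - (if i = k then 1 else 0) - (if j = k then 1 else 0) := by
    intro k
    split_ifs <;> grind
  simp_rw [h, sum_sub_distrib]
  simp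
  ring

theorem Trev_inducedTriplets {n : ℕ} (H0 H1 : HTree n) (hH1 : IsHierarchy H1) :
    Trev H1 (inducedTriplets H0) = ∑ i, ∑ j, ∑ k, H0.tripletInd i j k *
      (∑ l, H1.tripletInd i j l - ∑ l, H1.tripletInd i k l) := by
  rw [Trev, inducedTriplets, sum_filter, Fintype.sum_prod_type]
  refine sum_congr rfl fun i _ => ?_
  rw [Fintype.sum_prod_type]
  refine sum_congr rfl fun j _ => sum_congr rfl fun k _ => ?_
  dsimp only [HTree.tripletInd]
  split_ifs with h
  · have h1 := H1.sum_tripletInd hH1 h.1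
    have h2 := H1.sum_tripletInd hH1 h.2.1
    simp only [HTree.tripletInd] at h1 h2
    rw [h1, h2]
    ring
  · simp

/-- The number of triplets induced by a hierarchy depends only on the number of objects. -/
theorem three_mul_sum_tripletInd {n : ℕ} (H : HTree n) (hH : IsHierarchy H) :
    3 * ∑ i, ∑ j, ∑ k, H.tripletInd i j k =
      ∑ i : Fin n, ∑ j, ∑ k, (if i ≠ j ∧ i ≠ k ∧ j ≠ k then 1 else 0 : ℤ) := by
  simp_rw [← H.tripletInd_cyclic_sum hH, sum_add_distrib]
  have h1 : ∑ i, ∑ j, ∑ k, H.tripletInd i k j = ∑ i, ∑ j, ∑ k, H.tripletInd i j k :=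
    sum_congr rfl fun i _ => sum_comm
  have h2 : ∑ i, ∑ j, ∑ k, H.tripletInd j k i = ∑ i, ∑ j, ∑ k, H.tripletInd i j k := by
    rw [sum_comm]
    exact sum_congr rfl fun i _ => sum_comm
  rw [h1, h2]
  ring

theorem two_mul_Trev_inducedTriplets {n : ℕ} (H0 H1 : HTree n)
    (hH0 : IsHierarchy H0) (hH1 : IsHierarchy H1) :
    2 * Trev H1 (inducedTriplets H0) =
      3 * ∑ i, ∑ j, (∑ k, H0.tripletInd i j k) * (∑ k, H1.tripletInd i j k) -
        (n - 2) * ∑ i, ∑ j, ∑ k, H1.tripletInd i j k := by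
  rw [Trev_inducedTriplets H0 H1 hH1]
  set c : Fin n → Fin n → ℤ := fun i j => ∑ k, H1.tripletInd i j k with hc
  have hcs : ∀ i j, c i j = c j i := fun i j =>
    sum_congr rfl fun k _ => H1.tripletInd_comm i j k
  have h1 : ∑ i, ∑ j, ∑ k, H0.tripletInd i k j * c i j =
      ∑ i, ∑ j, ∑ k, H0.tripletInd i j k * c i k :=
    sum_congr rfl fun i _ => sum_comm
  have h2 : ∑ i, ∑ j, ∑ k, H0.tripletInd j k i * c i j =
      ∑ i, ∑ j, ∑ k, H0.tripletInd i j k * c i k := by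
    rw [sum_comm]
    refine sum_congr rfl fun i _ => ?_
    rw [sum_comm]
    simp_rw [hcs i]
  have h3 : ∑ i, ∑ j, ∑ k, (H0.tripletInd i j k + H0.tripletInd i k j + H0.tripletInd j k i) *
      c i j = (n - 2) * ∑ i, ∑ j, c i j := by
    simp_rw [mul_sum]
    refine sum_congr rfl fun i _ => sum_congr rfl fun j _ => ?_
    simp_rw [H0.tripletInd_cyclic_sum hH0, ← sum_mul]
    by_cases hij : i = j
    · subst hij
      simp [hc, HTree.tripletInd_self]
    · rw [sum_distinct_third hij]
  simp_rw [add_mul, sum_add_distrib] at h3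
  rw [h1, h2] at h3
  simp_rw [mul_sub, sum_sub_distrib, sum_mul]
  linarith

/-- For hierarchies `H0, H1` with induced triplet sets `T0, T1`,
`Trev(H0, T1) = Trev(H1, T0)`. -/
theorem trev_swap_symm {n : ℕ} (H0 H1 : HTree n)
    (hH0 : IsHierarchy H0) (hH1 : IsHierarchy H1) :
    Trev H0 (inducedTriplets H1) = Trev H1 (inducedTriplets H0) := by
  have h0 := two_mul_Trev_inducedTriplets H0 H1 hH0 hH1
  have h1 := two_mul_Trev_inducedTriplets H1 H0 hH1 hH0
  have hs := (three_mul_sum_tripletInd H0 hH0).trans (three_mul_sum_tripletInd H1 hH1).symm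
  simp_rw [mul_comm (∑ k, H1.tripletInd _ _ k)] at h1
  rw [mul_right_injective₀ three_ne_zero hs] at h1
  linarith

end CompHC
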